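/- Let F(s) = −Σ_{j=1}^{∞} j·ln(1 − e^{js}) for s < 0 be the fulcrum of the MacMahon function M(z) = ∏_{j=1}^{∞} (1 − z^j)^{−j}, the ordinary generating function of plane partitions. Then for every integer m ≥ 0, F^{(m)}(−s) ~ ζ(3)·Γ(m + 2)·s^{−(m+2)} as s ↓ 0, i.e. the ratio of the two sides tends to 1. -/

import Mathlib

open scoped BigOperators Topology
open Filter

namespace KhinchinPaper

/-- Sum of the power series with coefficients `a` at `t`. -/
noncomputable def fsum (a : ℕ → ℝ) (t : ℝ) : ℝ := ∑' n : ℕ, a n * t ^ n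

/-- The class `𝒦`: non-constant power series with non-negative coefficients, `a 0 > 0`,
and radius of convergence `R > 0`. -/
structure IsK (a : ℕ → ℝ) (R : ℝ) : Prop where
  pos₀ : 0 < a 0
  nonneg : ∀ n, 0 ≤ a n
  nonconst : ∃ n, 0 < n ∧ 0 < a n
  Rpos : 0 < R
  conv : ∀ t : ℝ, 0 ≤ t → t < R → Summable fun n : ℕ => a n * t ^ n
  radius : ∀ t : ℝ, R < t → ¬ Summable fun n : ℕ => a n * t ^ n

/-- Mean function `m_f(t) = t f'(t)/f(t)`. -/
noncomputable def mf (a : ℕ → ℝ) (t : ℝ) : ℝ :=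
  (∑' n : ℕ, (n : ℝ) * a n * t ^ n) / fsum a t

/-- Variance function `σ_f²(t)`. -/
noncomputable def sigma2 (a : ℕ → ℝ) (t : ℝ) : ℝ :=
  (∑' n : ℕ, (n : ℝ) ^ 2 * a n * t ^ n) / fsum a t - (mf a t) ^ 2

noncomputable def sigma (a : ℕ → ℝ) (t : ℝ) : ℝ := Real.sqrt (sigma2 a t)

/-- `k`-th moment of the normalized Khinchin family variable `X̆_t`. -/
noncomputable def normMoment (a : ℕ → ℝ) (t : ℝ) (k : ℕ) : ℝ :=
  ∑' n : ℕ, (a n * t ^ n / fsum a t) * (((n : ℝ) - mf a t) / sigma a t) ^ k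

/-- `k`-th central moment of `X_t`. -/
noncomputable def centralMoment (a : ℕ → ℝ) (t : ℝ) (k : ℕ) : ℝ :=
  ∑' n : ℕ, (a n * t ^ n / fsum a t) * ((n : ℝ) - mf a t) ^ k

/-- Characteristic function `E(e^{iθ X̆_t})` of the normalized variable. -/
noncomputable def charfun (a : ℕ → ℝ) (t θ : ℝ) : ℂ :=
  ∑' n : ℕ, ((a n * t ^ n / fsum a t : ℝ) : ℂ) *
    Complex.exp (Complex.I * (θ : ℂ) * ((((n : ℝ) - mf a t) / sigma a t : ℝ) : ℂ))

/-- `f` is Gaussian: `X̆_t → N(0,1)` in distribution as `t ↑ R`, expressed via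
pointwise convergence of characteristic functions (Lévy's continuity theorem). -/
def IsGaussian (a : ℕ → ℝ) (R : ℝ) : Prop :=
  ∀ θ : ℝ, Tendsto (fun t => charfun a t θ) (𝓝[<] R)
    (𝓝 (Complex.exp (-(θ : ℂ) ^ 2 / 2)))

/-- Gaussian for entire `f` (radius `R = ∞`, so `t → +∞`). -/
def IsGaussianEntire (a : ℕ → ℝ) : Prop :=
  ∀ θ : ℝ, Tendsto (fun t => charfun a t θ) atTop
    (𝓝 (Complex.exp (-(θ : ℂ) ^ 2 / 2)))

/-- The fulcrum `F(s) = log f(e^s)` restricted to the real axis. -/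
noncomputable def fulcrum (a : ℕ → ℝ) (s : ℝ) : ℝ := Real.log (fsum a (Real.exp s))

/-- The quotient `F^{(j)}(s) / F''(s)^{j/2}`. -/
noncomputable def Fq (a : ℕ → ℝ) (j : ℕ) (s : ℝ) : ℝ :=
  iteratedDeriv j (fulcrum a) s / (iteratedDeriv 2 (fulcrum a) s) ^ ((j : ℝ) / 2)

/-- Tuples `(m₂, …, m_n)` of non-negative integers with `2m₂ + ⋯ + n m_n = n`,
padded with `m₀ = m₁ = 0` and encoded as functions on `Fin (n+1)`. -/
def tuples (n : ℕ) : Finset (Fin (n + 1) → ℕ) :=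
  (Fintype.piFinset fun _ : Fin (n + 1) => Finset.range (n + 1)).filter
    fun m => m 0 = 0 ∧ m 1 = 0 ∧ ∑ j : Fin (n + 1), (j : ℕ) * m j = n

/-- Integer moments of a standard normal random variable `Z`. -/
noncomputable def gaussMoment (k : ℕ) : ℝ :=
  if Even k then (Nat.factorial k : ℝ) / ((Nat.factorial (k / 2) : ℝ) * 2 ^ (k / 2)) else 0

/-- The complex power series sum. -/
noncomputable def fsumC (a : ℕ → ℝ) (z : ℂ) : ℂ := ∑' n : ℕ, (a n : ℂ) * z ^ n

/-- The complex fulcrum `F(z) = log f(e^z)`. -/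
noncomputable def fulcrumC (a : ℕ → ℝ) (z : ℂ) : ℂ := Complex.log (fsumC a (Complex.exp z))

end KhinchinPaper

namespace KhinchinPaper

/-- The `m`-th derivative in `u` of the term `j * exp (j * k * u) / k`, where `j = p.1 + 1` and
`k = p.2 + 1`. -/
noncomputable def fulcrumTerm (m : ℕ) (p : ℕ × ℕ) (u : ℝ) : ℝ :=
  ((p.1 : ℝ) + 1) ^ (m + 1) * (((p.2 : ℝ) + 1) ^ m / ((p.2 : ℝ) + 1)) *
    Real.exp (((p.1 : ℝ) + 1) * ((p.2 : ℝ) + 1) * u)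

theorem fulcrumTerm_nonneg (m : ℕ) (p : ℕ × ℕ) (u : ℝ) : 0 ≤ fulcrumTerm m p u := by
  unfold fulcrumTerm
  positivity

theorem fulcrumTerm_mono (m : ℕ) (p : ℕ × ℕ) : Monotone (fulcrumTerm m p) := by
  intro u v huv
  unfold fulcrumTerm
  gcongr

theorem summable_succ_pow_mul_exp (n : ℕ) {x : ℝ} (hx : 0 < x) :
    Summable fun j : ℕ => ((j : ℝ) + 1) ^ n * Real.exp (-(((j : ℝ) + 1) * x)) := by
  have h := (summable_nat_add_iff 1).mpr (Real.summable_pow_mul_exp_neg_nat_mul n hx)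
  refine h.congr fun j => ?_
  push_cast
  ring_nf

theorem summable_fulcrumTerm (m : ℕ) {u : ℝ} (hu : u < 0) :
    Summable fun p => fulcrumTerm m p u := by
  have hx : 0 < -u / 2 := by linarith
  have h := (summable_succ_pow_mul_exp (m + 1) hx).mul_of_nonneg
    (summable_succ_pow_mul_exp m hx) (fun _ => by positivity) (fun _ => by positivity)
  refine h.of_nonneg_of_le (fun p => fulcrumTerm_nonneg m p u) fun p => ?_
  have ha : (0 : ℝ) ≤ p.1 := p.1.cast_nonneg
  have hb : (0 : ℝ) ≤ p.2 := p.2.cast_nonneg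
  have hexp : Real.exp (((p.1 : ℝ) + 1) * ((p.2 : ℝ) + 1) * u) ≤
      Real.exp (-(((p.1 : ℝ) + 1) * (-u / 2))) * Real.exp (-(((p.2 : ℝ) + 1) * (-u / 2))) := by
    rw [← Real.exp_add, Real.exp_le_exp]
    nlinarith [mul_nonneg ha hb, mul_nonneg (mul_nonneg ha hb) (neg_nonneg.mpr hu.le),
      mul_nonneg ha (neg_nonneg.mpr hu.le), mul_nonneg hb (neg_nonneg.mpr hu.le)]
  have hdiv : ((p.2 : ℝ) + 1) ^ m / ((p.2 : ℝ) + 1) ≤ ((p.2 : ℝ) + 1) ^ m :=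
    div_le_self (by positivity) (by linarith)
  calc fulcrumTerm m p u ≤ ((p.1 : ℝ) + 1) ^ (m + 1) * ((p.2 : ℝ) + 1) ^ m *
        (Real.exp (-(((p.1 : ℝ) + 1) * (-u / 2))) *
          Real.exp (-(((p.2 : ℝ) + 1) * (-u / 2)))) := by
        unfold fulcrumTerm
        gcongr
    _ = _ := by ring

theorem hasDerivAt_fulcrumTerm (m : ℕ) (p : ℕ × ℕ) (u : ℝ) :
    HasDerivAt (fulcrumTerm m p) (fulcrumTerm (m + 1) p u) u := by
  unfold fulcrumTerm
  have h := (((hasDerivAt_id u).const_mul (((p.1 : ℝ) + 1) * ((p.2 : ℝ) + 1))).exp).const_mul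
    (((p.1 : ℝ) + 1) ^ (m + 1) * (((p.2 : ℝ) + 1) ^ m / ((p.2 : ℝ) + 1)))
  refine h.congr_deriv ?_
  simp only [id]
  ring

theorem hasDerivAt_tsum_fulcrumTerm (m : ℕ) {u : ℝ} (hu : u < 0) :
    HasDerivAt (fun v => ∑' p, fulcrumTerm m p v) (∑' p, fulcrumTerm (m + 1) p u) u := by
  have hu' : u / 2 < 0 := by linarith
  have hmem : u ∈ Set.Iio (u / 2) := by
    rw [Set.mem_Iio]
    linarith
  refine hasDerivAt_tsum_of_isPreconnected (summable_fulcrumTerm (m + 1) hu') isOpen_Iio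
    isPreconnected_Iio (fun p v _ => hasDerivAt_fulcrumTerm m p v) (fun p v hv => ?_) hmem
    (summable_fulcrumTerm m hu) hmem
  rw [Real.norm_of_nonneg (fulcrumTerm_nonneg _ _ _)]
  exact fulcrumTerm_mono _ _ (le_of_lt hv)

theorem neg_tsum_log_eq_tsum_fulcrumTerm {u : ℝ} (hu : u < 0) :
    -∑' j : ℕ, ((j : ℝ) + 1) * Real.log (1 - Real.exp (((j : ℝ) + 1) * u)) =
      ∑' p, fulcrumTerm 0 p u := by
  rw [(summable_fulcrumTerm 0 hu).tsum_prod, ← tsum_neg]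
  refine tsum_congr fun j => ?_
  have hx : |Real.exp (((j : ℝ) + 1) * u)| < 1 := by
    rw [abs_of_pos (Real.exp_pos _), Real.exp_lt_one_iff]
    exact mul_neg_of_pos_of_neg (by positivity) hu
  have h := ((Real.hasSum_pow_div_log_of_abs_lt_one hx).mul_left ((j : ℝ) + 1)).tsum_eq
  rw [← mul_neg, ← h]
  refine tsum_congr fun k => ?_
  rw [← Real.exp_nat_mul]
  simp only [fulcrumTerm]
  push_cast
  ring_nf

theorem iteratedDeriv_neg_tsum_log (m : ℕ) {u : ℝ} (hu : u < 0) :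
    iteratedDeriv m
      (fun u : ℝ => -∑' j : ℕ, ((j : ℝ) + 1) * Real.log (1 - Real.exp (((j : ℝ) + 1) * u))) u =
      ∑' p, fulcrumTerm m p u := by
  induction m generalizing u with
  | zero => simpa only [iteratedDeriv_zero] using neg_tsum_log_eq_tsum_fulcrumTerm hu
  | succ m ih =>
    rw [iteratedDeriv_succ, ← (hasDerivAt_tsum_fulcrumTerm m hu).deriv]
    apply Filter.EventuallyEq.deriv_eq
    filter_upwards [Iio_mem_nhds hu] with v hv using ih hv

/-- The normalised polylogarithmic sum `x ^ (n + 1) * ∑_{j ≥ 1} j ^ n * exp (-j * x)`. -/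
noncomputable def scaledPowExpSum (n : ℕ) (x : ℝ) : ℝ :=
  x ^ (n + 1) * ∑' j : ℕ, ((j : ℝ) + 1) ^ n * Real.exp (-(((j : ℝ) + 1) * x))

theorem tsum_fulcrumTerm_neg (m : ℕ) {s : ℝ} (hs : 0 < s) :
    ∑' p, fulcrumTerm m p (-s) =
      (∑' k : ℕ, 1 / ((k : ℝ) + 1) ^ 3 * scaledPowExpSum (m + 1) (((k : ℝ) + 1) * s)) /
        s ^ (m + 2) := by
  have h := summable_fulcrumTerm m (neg_neg_of_pos hs)
  rw [h.tsum_prod, ← Summable.tsum_comm (f := fun j k => fulcrumTerm m (j, k) (-s)) h,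
    ← tsum_div_const]
  refine tsum_congr fun k => ?_
  unfold scaledPowExpSum
  rw [← tsum_mul_left, ← tsum_mul_left, ← tsum_div_const]
  refine tsum_congr fun j => ?_
  have hk : (k : ℝ) + 1 ≠ 0 := by positivity
  have he : -(((j : ℝ) + 1) * (((k : ℝ) + 1) * s)) = ((j : ℝ) + 1) * ((k : ℝ) + 1) * -s := by ring
  simp only [fulcrumTerm, he, mul_pow]
  field_simp
  ring

theorem hasSum_factorial_mul_choose_mul_exp (n : ℕ) {x : ℝ} (hx : 0 < x) :
    HasSum (fun j : ℕ => (n.factorial * (j + n).choose n : ℝ) * Real.exp (-x) ^ j)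
      (n.factorial * (1 / (1 - Real.exp (-x)) ^ (n + 1))) := by
  have hr : ‖Real.exp (-x)‖ < 1 := by
    rw [Real.norm_of_nonneg (Real.exp_pos _).le, Real.exp_lt_one_iff]
    linarith
  simpa only [mul_assoc] using
    (hasSum_choose_mul_geometric_of_norm_lt_one n hr).mul_left (n.factorial : ℝ)

theorem scaledPowExpSum_nonneg (n : ℕ) {x : ℝ} (hx : 0 < x) : 0 ≤ scaledPowExpSum n x := by
  unfold scaledPowExpSum
  exact mul_nonneg (by positivity) (tsum_nonneg fun _ => by positivity)

theorem scaledPowExpSum_le (n : ℕ) {x : ℝ} (hx : 0 < x) :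
    scaledPowExpSum n x ≤
      n.factorial * Real.exp (-x) * (x / (1 - Real.exp (-x))) ^ (n + 1) := by
  have h := (hasSum_factorial_mul_choose_mul_exp n hx).mul_left (Real.exp (-x))
  have hle : ∑' j : ℕ, ((j : ℝ) + 1) ^ n * Real.exp (-(((j : ℝ) + 1) * x)) ≤
      Real.exp (-x) * (n.factorial * (1 / (1 - Real.exp (-x)) ^ (n + 1))) := by
    rw [← h.tsum_eq]
    refine (summable_succ_pow_mul_exp n hx).tsum_le_tsum (fun j => ?_) h.summable
    have hexp : Real.exp (-(((j : ℝ) + 1) * x)) = Real.exp (-x) * Real.exp (-x) ^ j := by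
      rw [← Real.exp_nat_mul, ← Real.exp_add]
      ring_nf
    have hpow : ((j : ℝ) + 1) ^ n ≤ n.factorial * (j + n).choose n := by
      have := Nat.pow_succ_le_ascFactorial (j + 1) n
      rw [Nat.ascFactorial_eq_factorial_mul_choose] at this
      exact_mod_cast this
    rw [hexp]
    calc _ ≤ (n.factorial * (j + n).choose n : ℝ) * (Real.exp (-x) * Real.exp (-x) ^ j) := by
          gcongr
      _ = _ := by ring
  calc scaledPowExpSum n x ≤
        x ^ (n + 1) * (Real.exp (-x) * (n.factorial * (1 / (1 - Real.exp (-x)) ^ (n + 1)))) := by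
        unfold scaledPowExpSum
        gcongr
    _ = _ := by
        rw [div_pow]
        ring

theorem le_scaledPowExpSum {n : ℕ} (hn : n ≠ 0) {x : ℝ} (hx : 0 < x) :
    n.factorial * Real.exp (-x) ^ n * (x / (1 - Real.exp (-x))) ^ (n + 1) ≤
      scaledPowExpSum n x := by
  obtain ⟨n, rfl⟩ := Nat.exists_eq_add_one_of_ne_zero hn
  have h := (hasSum_factorial_mul_choose_mul_exp (n + 1) hx).mul_left (Real.exp (-x) ^ (n + 1))
  have hs := summable_succ_pow_mul_exp (n + 1) hx
  have hle : Real.exp (-x) ^ (n + 1) *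
        ((n + 1).factorial * (1 / (1 - Real.exp (-x)) ^ (n + 1 + 1))) ≤
      ∑' j : ℕ, ((j : ℝ) + 1) ^ (n + 1) * Real.exp (-(((j : ℝ) + 1) * x)) := by
    rw [← h.tsum_eq]
    refine h.summable.tsum_le_tsum_of_inj (fun j => j + n) (add_left_injective n)
      (fun _ _ => by positivity) (fun j => ?_) hs
    have hexp : Real.exp (-((((j + n : ℕ) : ℝ) + 1) * x)) =
        Real.exp (-x) ^ (n + 1) * Real.exp (-x) ^ j := by
      rw [← pow_add, ← Real.exp_nat_mul]
      push_cast
      ring_nf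
    have hpow : ((n + 1).factorial * (j + (n + 1)).choose (n + 1) : ℝ) ≤
        (((j + n : ℕ) : ℝ) + 1) ^ (n + 1) := by
      have := Nat.descFactorial_le_pow (j + (n + 1)) (n + 1)
      rw [Nat.descFactorial_eq_factorial_mul_choose] at this
      exact_mod_cast this
    rw [hexp]
    calc _ = ((n + 1).factorial * (j + (n + 1)).choose (n + 1) : ℝ) *
          (Real.exp (-x) ^ (n + 1) * Real.exp (-x) ^ j) := by ring
      _ ≤ _ := by gcongr
  calc _ = x ^ (n + 1 + 1) * (Real.exp (-x) ^ (n + 1) *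
        ((n + 1).factorial * (1 / (1 - Real.exp (-x)) ^ (n + 1 + 1)))) := by
        rw [div_pow]
        ring
    _ ≤ _ := by
        unfold scaledPowExpSum
        gcongr

theorem tendsto_div_one_sub_exp_neg :
    Tendsto (fun x : ℝ => x / (1 - Real.exp (-x))) (𝓝[>] 0) (𝓝 1) := by
  have hd : HasDerivAt (fun x : ℝ => 1 - Real.exp (-x)) 1 0 := by
    simpa using ((hasDerivAt_neg (0 : ℝ)).exp).const_sub 1
  have h := (hd.tendsto_slope.mono_left (nhdsGT_le_nhdsNE 0)).inv₀ one_ne_zero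
  rw [inv_one] at h
  refine h.congr fun x => ?_
  simp [slope_def_field]

theorem tendsto_scaledPowExpSum {n : ℕ} (hn : n ≠ 0) :
    Tendsto (scaledPowExpSum n) (𝓝[>] 0) (𝓝 n.factorial) := by
  have hexp : Tendsto (fun x : ℝ => Real.exp (-x)) (𝓝[>] 0) (𝓝 1) := by
    have h : Continuous fun x : ℝ => Real.exp (-x) := by fun_prop
    simpa using (h.tendsto 0).mono_left nhdsWithin_le_nhds
  have hq := tendsto_div_one_sub_exp_neg.pow (n + 1)
  have hlow := ((hexp.pow n).const_mul (n.factorial : ℝ)).mul hq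
  have hupp := (hexp.const_mul (n.factorial : ℝ)).mul hq
  simp only [one_pow, mul_one] at hlow hupp
  refine tendsto_of_tendsto_of_tendsto_of_le_of_le' hlow hupp ?_ ?_
  · filter_upwards [self_mem_nhdsWithin] with x hx using le_scaledPowExpSum hn hx
  · filter_upwards [self_mem_nhdsWithin] with x hx using scaledPowExpSum_le n hx

theorem scaledPowExpSum_le_const (n : ℕ) {x : ℝ} (hx : 0 < x) :
    scaledPowExpSum n x ≤ n.factorial * ((n : ℝ) + 1) ^ (n + 1) := by
  have hn : (0 : ℝ) < n + 1 := by positivity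
  have hlt : 0 < 1 - Real.exp (-x) := by
    rw [sub_pos, Real.exp_lt_one_iff]
    linarith
  have hdiv : x / (1 - Real.exp (-x)) ≤ 1 + x := by
    rw [div_le_iff₀ hlt]
    have h1 : Real.exp (-x) * (1 + x) ≤ 1 := by
      rw [Real.exp_neg, inv_mul_le_iff₀ (Real.exp_pos x)]
      linarith [Real.add_one_le_exp x]
    linarith
  have hone : 1 + x ≤ (n + 1) * Real.exp (x / (n + 1)) := by
    have h1 := mul_le_mul_of_nonneg_left (Real.add_one_le_exp (x / (n + 1))) hn.le
    rw [mul_add, mul_div_cancel₀ _ hn.ne'] at h1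
    linarith [n.cast_nonneg (α := ℝ)]
  have hexp : Real.exp (x / (n + 1)) ^ (n + 1) = Real.exp x := by
    rw [← Real.exp_nat_mul]
    push_cast
    rw [mul_div_cancel₀ _ hn.ne']
  calc scaledPowExpSum n x
      ≤ n.factorial * Real.exp (-x) * (x / (1 - Real.exp (-x))) ^ (n + 1) :=
        scaledPowExpSum_le n hx
    _ ≤ n.factorial * Real.exp (-x) * ((n + 1) * Real.exp (x / (n + 1))) ^ (n + 1) := by
        have := div_nonneg hx.le hlt.le
        gcongr
        exact hdiv.trans hone
    _ = n.factorial * ((n : ℝ) + 1) ^ (n + 1) * (Real.exp (-x) * Real.exp x) := by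
        rw [mul_pow, hexp]
        ring
    _ = _ := by rw [← Real.exp_add, neg_add_cancel, Real.exp_zero, mul_one]

theorem summable_one_div_succ_cube : Summable fun k : ℕ => 1 / ((k : ℝ) + 1) ^ 3 := by
  have h := (summable_nat_add_iff 1).mpr (Real.summable_one_div_nat_pow.mpr (by decide : 1 < 3))
  simpa using h

theorem tendsto_tsum_scaledPowExpSum {n : ℕ} (hn : n ≠ 0) :
    Tendsto (fun s : ℝ => ∑' k : ℕ, 1 / ((k : ℝ) + 1) ^ 3 * scaledPowExpSum n (((k : ℝ) + 1) * s))
      (𝓝[>] 0) (𝓝 ((∑' k : ℕ, 1 / ((k : ℝ) + 1) ^ 3) * (n.factorial : ℝ))) := by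
  rw [← tsum_mul_right]
  refine tendsto_tsum_of_dominated_convergence
    (summable_one_div_succ_cube.mul_right (n.factorial * ((n : ℝ) + 1) ^ (n + 1)))
    (fun k => ?_) ?_
  · refine ((tendsto_scaledPowExpSum hn).comp ?_).const_mul _
    refine tendsto_nhdsWithin_iff.mpr ⟨?_, ?_⟩
    · have h : Continuous fun s : ℝ => ((k : ℝ) + 1) * s := by fun_prop
      simpa using (h.tendsto 0).mono_left nhdsWithin_le_nhds
    · filter_upwards [self_mem_nhdsWithin] with s hs
      rw [Set.mem_Ioi] at hs ⊢
      positivity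
  · filter_upwards [self_mem_nhdsWithin] with s hs k
    have hks : 0 < ((k : ℝ) + 1) * s := mul_pos (by positivity) hs
    have hcube : 0 ≤ 1 / ((k : ℝ) + 1) ^ 3 := by positivity
    rw [Real.norm_of_nonneg (mul_nonneg hcube (scaledPowExpSum_nonneg n hks))]
    gcongr
    exact scaledPowExpSum_le_const n hks

/-- for the fulcrum `F(s) = -∑_{j≥1} j ln(1 - e^{js})` of the MacMahon
function, `F^{(m)}(-s) ~ ζ(3) Γ(m+2) / s^{m+2}` as `s ↓ 0`. -/
theorem statement13 (m : ℕ) :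
    Tendsto (fun s : ℝ =>
        iteratedDeriv m
            (fun u : ℝ => -∑' j : ℕ, ((j : ℝ) + 1) * Real.log (1 - Real.exp (((j : ℝ) + 1) * u)))
            (-s) /
          ((∑' k : ℕ, 1 / ((k : ℝ) + 1) ^ 3) * Real.Gamma ((m : ℝ) + 2) / s ^ (m + 2)))
      (𝓝[>] (0 : ℝ)) (𝓝 1) := by
  have hGamma : Real.Gamma ((m : ℝ) + 2) = (m + 1).factorial := by
    rw [← Real.Gamma_nat_eq_factorial]
    push_cast
    ring_nf
  have hzeta : 0 < ∑' k : ℕ, 1 / ((k : ℝ) + 1) ^ 3 :=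
    summable_one_div_succ_cube.tsum_pos (fun _ => by positivity) 0 (by positivity)
  have hne : (∑' k : ℕ, 1 / ((k : ℝ) + 1) ^ 3) * ((m + 1).factorial : ℝ) ≠ 0 := by positivity
  have h := (tendsto_tsum_scaledPowExpSum m.succ_ne_zero).div_const
    ((∑' k : ℕ, 1 / ((k : ℝ) + 1) ^ 3) * ((m + 1).factorial : ℝ))
  rw [Nat.succ_eq_add_one, div_self hne] at h
  refine h.congr' ?_
  filter_upwards [self_mem_nhdsWithin] with s hs
  rw [Set.mem_Ioi] at hs
  rw [iteratedDeriv_neg_tsum_log m (neg_neg_of_pos hs), tsum_fulcrumTerm_neg m hs, hGamma,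
    div_div_div_cancel_right₀ (pow_ne_zero _ hs.ne')]

end KhinchinPaper
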